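/- arXiv:1204.0663 — 5 statements merged into one kernel-verified Lean document; each statement's English description precedes it below -/
import Mathlib

section
/- Let E be a finite-dimensional real inner product space, V : E → ℝ a smooth function, and ℏ > 0 a real number. Let ρ : ℝ × E → ℝ and φ : ℝ × E → ℝ be smooth functions with ρ(t,x) > 0 for all (t,x), satisfying for all (t,x): (i) ∂φ/∂t(t,x) = (1/2)·‖∇φ(t,·)(x)‖² + V(x) − (ℏ²/2)·Δ(√(ρ(t,·)))(x)/√(ρ(t,x)) and (ii) ∂ρ/∂t(t,x) = ⟨∇ρ(t,·)(x), ∇φ(t,·)(x)⟩ + ρ(t,x)·Δφ(t,·)(x) (i.e. ∂ρ/∂t = div(ρ∇φ)). Then the function ψ(t,x) := √(ρ(t,x))·exp(−(i/ℏ)·φ(t,x)) satisfies the Schrödinger equation iℏ·∂ψ/∂t(t,x) = −(ℏ²/2)·Δψ(t,·)(x) + V(x)·ψ(t,x). -/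
open scoped BigOperators RealInnerProductSpace

/-- The Laplacian of a function on a finite-dimensional real inner product space,
defined as the trace of the second Fréchet derivative, computed via an orthonormal basis. -/
noncomputable def laplacian {E : Type*} [NormedAddCommGroup E] [InnerProductSpace ℝ E]
    [FiniteDimensional ℝ E] {F : Type*} [NormedAddCommGroup F] [NormedSpace ℝ F]
    (f : E → F) (x : E) : F :=
  ∑ i, fderiv ℝ (fun y => fderiv ℝ f y (stdOrthonormalBasis ℝ E i)) x (stdOrthonormalBasis ℝ E i)

theorem fderiv_mul_cexp_ofReal_apply {E : Type*} [NormedAddCommGroup E] [NormedSpace ℝ E]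
    {A : E → ℂ} {φ : E → ℝ} {y : E} (hA : DifferentiableAt ℝ A y) (hφ : DifferentiableAt ℝ φ y)
    (c : ℂ) (e : E) :
    fderiv ℝ (fun z => A z * Complex.exp (c * (φ z : ℂ))) y e
      = (fderiv ℝ A y e + c * A y * (fderiv ℝ φ y e : ℂ)) * Complex.exp (c * (φ y : ℂ)) := by
  have hφ' := Complex.ofRealCLM.hasFDerivAt.comp y hφ.hasFDerivAt
  have h := hA.hasFDerivAt.mul (hφ'.const_mul c).cexp
  refine (congrArg (fun L : E →L[ℝ] ℂ => L e) h.fderiv).trans ?_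
  simp [smul_eq_mul]
  ring

theorem fderiv_ofReal_apply {E : Type*} [NormedAddCommGroup E] [NormedSpace ℝ E]
    {f : E → ℝ} {y : E} (hf : DifferentiableAt ℝ f y) (e : E) :
    fderiv ℝ (fun z => (f z : ℂ)) y e = (fderiv ℝ f y e : ℂ) := by
  have h := Complex.ofRealCLM.hasFDerivAt.comp y hf.hasFDerivAt
  exact congrArg (fun L : E →L[ℝ] ℂ => L e) h.fderiv

theorem fderiv_fderiv_ofReal_mul_cexp_apply {E : Type*} [NormedAddCommGroup E] [NormedSpace ℝ E]
    {R φ : E → ℝ} (hR : ContDiff ℝ 2 R) (hφ : ContDiff ℝ 2 φ) (c : ℂ) (x e : E) :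
    fderiv ℝ (fun y => fderiv ℝ (fun z => (R z : ℂ) * Complex.exp (c * (φ z : ℂ))) y e) x e
      = ((fderiv ℝ (fun y => fderiv ℝ R y e) x e : ℂ)
          + 2 * c * ((fderiv ℝ R x e : ℂ) * (fderiv ℝ φ x e : ℂ))
          + c * R x * (fderiv ℝ (fun y => fderiv ℝ φ y e) x e : ℂ)
          + c ^ 2 * R x * (fderiv ℝ φ x e : ℂ) ^ 2) * Complex.exp (c * (φ x : ℂ)) := by
  have dR : Differentiable ℝ R := hR.differentiable (by norm_num)
  have dφ : Differentiable ℝ φ := hφ.differentiable (by norm_num)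
  have ofReal_differentiable {f : E → ℝ} (hf : Differentiable ℝ f) :
      Differentiable ℝ (fun z => (f z : ℂ)) := Complex.ofRealCLM.differentiable.comp hf
  have dR' : Differentiable ℝ (fun y => fderiv ℝ R y e) :=
    ((hR.fderiv_right (m := 1) (by norm_num)).clm_apply contDiff_const).differentiable (by norm_num)
  have dφ' : Differentiable ℝ (fun y => fderiv ℝ φ y e) :=
    ((hφ.fderiv_right (m := 1) (by norm_num)).clm_apply contDiff_const).differentiable (by norm_num)
  have first (y : E) : fderiv ℝ (fun z => (R z : ℂ) * Complex.exp (c * (φ z : ℂ))) y e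
      = ((fderiv ℝ R y e : ℂ) + c * R y * (fderiv ℝ φ y e : ℂ))
        * Complex.exp (c * (φ y : ℂ)) := by
    rw [fderiv_mul_cexp_ofReal_apply (ofReal_differentiable dR y) (dφ y), fderiv_ofReal_apply (dR y)]
  have amplitude : HasFDerivAt
      (fun y => (fderiv ℝ R y e : ℂ) + c * R y * (fderiv ℝ φ y e : ℂ)) _ x :=
    (ofReal_differentiable dR' x).hasFDerivAt.add
      (((ofReal_differentiable dR x).hasFDerivAt.const_mul c).mul
        (ofReal_differentiable dφ' x).hasFDerivAt)
  simp_rw [first]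
  rw [fderiv_mul_cexp_ofReal_apply amplitude.differentiableAt (dφ x), amplitude.fderiv]
  simp only [add_apply, smul_apply, smul_eq_mul,
    fderiv_ofReal_apply (dR x), fderiv_ofReal_apply (dR' x), fderiv_ofReal_apply (dφ' x)]
  ring

theorem sum_fderiv_mul_fderiv_stdOrthonormalBasis {E : Type*} [NormedAddCommGroup E]
    [InnerProductSpace ℝ E] [FiniteDimensional ℝ E] (f g : E → ℝ) (x : E) :
    ∑ i, fderiv ℝ f x (stdOrthonormalBasis ℝ E i) * fderiv ℝ g x (stdOrthonormalBasis ℝ E i)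
      = ⟪gradient f x, gradient g x⟫ := by
  rw [← (stdOrthonormalBasis ℝ E).sum_inner_mul_inner]
  refine Finset.sum_congr rfl fun i _ => ?_
  rw [real_inner_comm (gradient g x)]
  simp [gradient]

theorem laplacian_ofReal_mul_cexp {E : Type*} [NormedAddCommGroup E]
    [InnerProductSpace ℝ E] [FiniteDimensional ℝ E]
    {R φ : E → ℝ} (hR : ContDiff ℝ 2 R) (hφ : ContDiff ℝ 2 φ) (c : ℂ) (x : E) :
    laplacian (fun z => (R z : ℂ) * Complex.exp (c * (φ z : ℂ))) x
      = (((laplacian R x : ℝ) : ℂ) + 2 * c * (⟪gradient R x, gradient φ x⟫ : ℝ)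
          + c * R x * ((laplacian φ x : ℝ) : ℂ)
          + c ^ 2 * R x * (‖gradient φ x‖ : ℂ) ^ 2) * Complex.exp (c * (φ x : ℂ)) := by
  rw [← Complex.ofReal_pow, ← real_inner_self_eq_norm_sq,
    ← sum_fderiv_mul_fderiv_stdOrthonormalBasis, ← sum_fderiv_mul_fderiv_stdOrthonormalBasis]
  simp only [laplacian, fderiv_fderiv_ofReal_mul_cexp_apply hR hφ, Complex.ofReal_sum,
    Complex.ofReal_mul, Finset.mul_sum, ← Finset.sum_add_distrib, ← Finset.sum_mul, ← pow_two,
    Complex.ofReal_pow]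

theorem gradient_eq_two_mul_sqrt_smul {E : Type*} [NormedAddCommGroup E]
    [InnerProductSpace ℝ E] [FiniteDimensional ℝ E] {f : E → ℝ} {x : E}
    (hf : DifferentiableAt ℝ f x) (hx : 0 < f x) :
    gradient f x = (2 * Real.sqrt (f x)) • gradient (fun y => Real.sqrt (f y)) x := by
  have hs : Real.sqrt (f x) ≠ 0 := (Real.sqrt_pos.2 hx).ne'
  rw [gradient, gradient, (hf.hasFDerivAt.sqrt hx.ne').fderiv, map_smul, smul_smul,
    mul_one_div_cancel (by positivity), one_smul]

theorem hydrodynamical_to_schrodinger {E : Type*} [NormedAddCommGroup E]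
    [InnerProductSpace ℝ E] [FiniteDimensional ℝ E]
    (V : E → ℝ) (hV : ContDiff ℝ (⊤ : ℕ∞) V) (ℏ : ℝ) (hℏ : 0 < ℏ)
    (ρ φ : ℝ → E → ℝ)
    (hρ : ContDiff ℝ (⊤ : ℕ∞) (Function.uncurry ρ)) (hφ : ContDiff ℝ (⊤ : ℕ∞) (Function.uncurry φ))
    (hpos : ∀ t x, 0 < ρ t x)
    (heq1 : ∀ t x, deriv (fun s => φ s x) t
      = (1 / 2) * ‖gradient (φ t) x‖ ^ 2 + V x
        - (ℏ ^ 2 / 2) * laplacian (fun y => Real.sqrt (ρ t y)) x / Real.sqrt (ρ t x))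
    (heq2 : ∀ t x, deriv (fun s => ρ s x) t
      = ⟪gradient (ρ t) x, gradient (φ t) x⟫ + ρ t x * laplacian (φ t) x)
    (ψ : ℝ → E → ℂ)
    (hψ : ∀ t x, ψ t x
      = (Real.sqrt (ρ t x) : ℂ) * Complex.exp (-(Complex.I / ℏ) * (φ t x : ℂ))) :
    ∀ t x, Complex.I * (ℏ : ℂ) * deriv (fun s => ψ s x) t
      = -((ℏ : ℂ) ^ 2 / 2) * laplacian (ψ t) x + (V x : ℂ) * ψ t x := by
  intro t x
  have contDiff_slice {f : ℝ → E → ℝ} (hf : ContDiff ℝ (⊤ : ℕ∞) (Function.uncurry f)) :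
      ContDiff ℝ 2 (f t) :=
    (hf.comp (contDiff_const.prodMk contDiff_id)).of_le (WithTop.coe_le_coe.2 (le_top : (2 : ℕ∞) ≤ ⊤))
  have differentiable_time {f : ℝ → E → ℝ} (hf : ContDiff ℝ (⊤ : ℕ∞) (Function.uncurry f)) :
      DifferentiableAt ℝ (fun s => f s x) t :=
    (hf.comp (contDiff_id.prodMk contDiff_const)).differentiable (by simp) t
  have hR : ContDiff ℝ 2 (fun y => Real.sqrt (ρ t y)) :=
    (contDiff_slice hρ).sqrt fun y => (hpos t y).ne'
  have hlap := laplacian_ofReal_mul_cexp hR (contDiff_slice hφ) (-(Complex.I / ℏ)) x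
  have hψt : ψ t = fun y => (Real.sqrt (ρ t y) : ℂ) * Complex.exp (-(Complex.I / ℏ) * (φ t y : ℂ)) :=
    funext (hψ t)
  have hψx : (fun s => ψ s x)
      = fun s => (Real.sqrt (ρ s x) : ℂ) * Complex.exp (-(Complex.I / ℏ) * (φ s x : ℂ)) :=
    funext fun s => hψ s x
  have hderiv : HasDerivAt
      (fun s => (Real.sqrt (ρ s x) : ℂ) * Complex.exp (-(Complex.I / ℏ) * (φ s x : ℂ))) _ t :=
    ((differentiable_time hρ).hasDerivAt.sqrt (hpos t x).ne').ofReal_comp.mul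
      ((differentiable_time hφ).hasDerivAt.ofReal_comp.const_mul (-(Complex.I / (ℏ : ℂ)))).cexp
  have hgrad := gradient_eq_two_mul_sqrt_smul
    ((contDiff_slice hρ).differentiable (by norm_num) x) (hpos t x)
  have hsq : ρ t x = Real.sqrt (ρ t x) ^ 2 := (Real.sq_sqrt (hpos t x).le).symm
  have hs : (Real.sqrt (ρ t x) : ℂ) ≠ 0 := by exact_mod_cast (Real.sqrt_pos.2 (hpos t x)).ne'
  have hℏ' : (ℏ : ℂ) ≠ 0 := by exact_mod_cast hℏ.ne'
  have hcont : deriv (fun s => ρ s x) t / (2 * Real.sqrt (ρ t x))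
      = ⟪gradient (fun y => Real.sqrt (ρ t y)) x, gradient (φ t) x⟫
        + Real.sqrt (ρ t x) * laplacian (φ t) x / 2 := by
    have hs' : Real.sqrt (ρ t x) ≠ 0 := (Real.sqrt_pos.2 (hpos t x)).ne'
    rw [heq2, hgrad, real_inner_smul_left, div_eq_iff (by positivity)]
    linear_combination laplacian (φ t) x * hsq
  rw [hψx, hderiv.deriv, hψt, hlap, hcont, heq1]
  push_cast
  field_simp
  ring_nf
  simp only [Complex.I_sq]
  ring_nf
end

section
/- Let E be a finite-dimensional real inner product space, V : E → ℝ a smooth function, and ℏ > 0 a real number. Let ρ : ℝ × E → ℝ and φ : ℝ × E → ℝ be smooth functions with ρ(t,x) > 0 for all (t,x), and suppose that the function ψ(t,x) := √(ρ(t,x))·exp(−(i/ℏ)·φ(t,x)) satisfies the Schrödinger equation iℏ·∂ψ/∂t(t,x) = −(ℏ²/2)·Δψ(t,·)(x) + V(x)·ψ(t,x) for all (t,x). Then for all (t,x): (i) ∂φ/∂t(t,x) = (1/2)·‖∇φ(t,·)(x)‖² + V(x) − (ℏ²/2)·Δ(√(ρ(t,·)))(x)/√(ρ(t,x)) and (ii)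 ∂ρ/∂t(t,x) = ⟨∇ρ(t,·)(x), ∇φ(t,·)(x)⟩ + ρ(t,x)·Δφ(t,·)(x) (i.e. ∂ρ/∂t = div(ρ∇φ)). -/
open scoped BigOperators RealInnerProductSpace

section

variable {E : Type*} [NormedAddCommGroup E]

section NormedSpace

variable [NormedSpace ℝ E]

theorem HasFDerivAt.fderiv_mul_cexp_apply {a : E → ℂ} {a' : E →L[ℝ] ℂ} {θ : E → ℝ} {x : E}
    (c : ℂ) (ha : HasFDerivAt a a' x) (hθ : DifferentiableAt ℝ θ x) (v : E) :
    fderiv ℝ (fun y => a y * Complex.exp (c * (θ y : ℂ))) x v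
      = (a' v + c * a x * (fderiv ℝ θ x v : ℂ)) * Complex.exp (c * (θ x : ℂ)) := by
  have hθ' : HasFDerivAt (fun y => (θ y : ℂ)) (Complex.ofRealCLM.comp (fderiv ℝ θ x)) x :=
    Complex.ofRealCLM.hasFDerivAt.comp x hθ.hasFDerivAt
  have h : HasFDerivAt (fun y => a y * Complex.exp (c * (θ y : ℂ))) _ x :=
    ha.mul (hθ'.const_mul c).cexp
  rw [h.fderiv]
  simp
  ring

theorem fderiv_fderiv_mul_cexp_apply {u θ : E → ℝ} (c : ℂ) (hu : ContDiff ℝ 2 u)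
    (hθ : ContDiff ℝ 2 θ) (x v : E) :
    fderiv ℝ (fun y => fderiv ℝ (fun z => (u z : ℂ) * Complex.exp (c * (θ z : ℂ))) y v) x v
      = ((fderiv ℝ (fun y => fderiv ℝ u y v) x v : ℂ)
          + 2 * c * ((fderiv ℝ u x v * fderiv ℝ θ x v : ℝ) : ℂ)
          + c * u x * (fderiv ℝ (fun y => fderiv ℝ θ y v) x v : ℂ)
          + c ^ 2 * u x * ((fderiv ℝ θ x v * fderiv ℝ θ x v : ℝ) : ℂ))
        * Complex.exp (c * (θ x : ℂ)) := by
  have du : Differentiable ℝ u := hu.differentiable (by norm_num)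
  have dθ : Differentiable ℝ θ := hθ.differentiable (by norm_num)
  have ddu : Differentiable ℝ (fun y => fderiv ℝ u y v) :=
    ((hu.fderiv_right (m := 1) (by norm_num)).clm_apply contDiff_const).differentiable
      (by norm_num)
  have ddθ : Differentiable ℝ (fun y => fderiv ℝ θ y v) :=
    ((hθ.fderiv_right (m := 1) (by norm_num)).clm_apply contDiff_const).differentiable
      (by norm_num)
  have ofReal {f : E → ℝ} (hf : Differentiable ℝ f) (y : E) :
      HasFDerivAt (fun z => (f z : ℂ)) (Complex.ofRealCLM.comp (fderiv ℝ f y)) y :=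
    Complex.ofRealCLM.hasFDerivAt.comp y (hf y).hasFDerivAt
  have first : (fun y => fderiv ℝ (fun z => (u z : ℂ) * Complex.exp (c * (θ z : ℂ))) y v)
      = fun y => ((fderiv ℝ u y v : ℂ) + c * u y * (fderiv ℝ θ y v : ℂ))
          * Complex.exp (c * (θ y : ℂ)) := by
    funext y
    rw [(ofReal du y).fderiv_mul_cexp_apply c (dθ y) v]
    simp
  have amplitude : HasFDerivAt
      (fun y => (fderiv ℝ u y v : ℂ) + c * u y * (fderiv ℝ θ y v : ℂ)) _ x :=
    (ofReal ddu x).add (((ofReal du x).const_mul c).mul (ofReal ddθ x))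
  rw [first, amplitude.fderiv_mul_cexp_apply c (dθ x) v]
  simp
  ring

end NormedSpace

variable [InnerProductSpace ℝ E] [FiniteDimensional ℝ E]

theorem inner_gradient_gradient_eq_sum (f g : E → ℝ) (x : E) :
    ⟪gradient f x, gradient g x⟫ = ∑ i, fderiv ℝ f x (stdOrthonormalBasis ℝ E i)
      * fderiv ℝ g x (stdOrthonormalBasis ℝ E i) := by
  rw [← (stdOrthonormalBasis ℝ E).sum_inner_mul_inner]
  refine Finset.sum_congr rfl fun i _ => ?_
  rw [real_inner_comm (gradient g x)]
  simp [gradient]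

theorem laplacian_mul_cexp {u θ : E → ℝ} (c : ℂ) (hu : ContDiff ℝ 2 u)
    (hθ : ContDiff ℝ 2 θ) (x : E) :
    laplacian (fun y => (u y : ℂ) * Complex.exp (c * (θ y : ℂ))) x
      = (((laplacian u x : ℝ) : ℂ) + 2 * c * (⟪gradient u x, gradient θ x⟫ : ℂ)
          + c * u x * ((laplacian θ x : ℝ) : ℂ) + c ^ 2 * u x * ((‖gradient θ x‖ ^ 2 : ℝ) : ℂ))
        * Complex.exp (c * (θ x : ℂ)) := by
  rw [← real_inner_self_eq_norm_sq, inner_gradient_gradient_eq_sum,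
    inner_gradient_gradient_eq_sum]
  simp only [laplacian, fderiv_fderiv_mul_cexp_apply c hu hθ, ← Finset.sum_mul,
    Finset.sum_add_distrib, ← Finset.mul_sum, Complex.ofReal_sum]

end

theorem schrodinger_to_hydrodynamical {E : Type*} [NormedAddCommGroup E]
    [InnerProductSpace ℝ E] [FiniteDimensional ℝ E]
    (V : E → ℝ) (hV : ContDiff ℝ (⊤ : ℕ∞) V) (ℏ : ℝ) (hℏ : 0 < ℏ)
    (ρ φ : ℝ → E → ℝ)
    (hρ : ContDiff ℝ (⊤ : ℕ∞) (Function.uncurry ρ)) (hφ : ContDiff ℝ (⊤ : ℕ∞) (Function.uncurry φ))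
    (hpos : ∀ t x, 0 < ρ t x)
    (ψ : ℝ → E → ℂ)
    (hψ : ∀ t x, ψ t x
      = (Real.sqrt (ρ t x) : ℂ) * Complex.exp (-(Complex.I / ℏ) * (φ t x : ℂ)))
    (hschrodinger : ∀ t x, Complex.I * (ℏ : ℂ) * deriv (fun s => ψ s x) t
      = -((ℏ : ℂ) ^ 2 / 2) * laplacian (ψ t) x + (V x : ℂ) * ψ t x) :
    (∀ t x, deriv (fun s => φ s x) t
      = (1 / 2) * ‖gradient (φ t) x‖ ^ 2 + V x
        - (ℏ ^ 2 / 2) * laplacian (fun y => Real.sqrt (ρ t y)) x / Real.sqrt (ρ t x))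
    ∧ (∀ t x, deriv (fun s => ρ s x) t
      = ⟪gradient (ρ t) x, gradient (φ t) x⟫ + ρ t x * laplacian (φ t) x) := by
  have hR : ContDiff ℝ (⊤ : ℕ∞) (Function.uncurry fun t x => √(ρ t x)) :=
    hρ.sqrt fun p => (hpos p.1 p.2).ne'
  have space {f : ℝ → E → ℝ} (hf : ContDiff ℝ (⊤ : ℕ∞) (Function.uncurry f)) (t : ℝ) :
      ContDiff ℝ 2 (f t) :=
    contDiff_infty.1 (hf.comp (contDiff_prodMk_right t)) 2
  have time {f : ℝ → E → ℝ} (hf : ContDiff ℝ (⊤ : ℕ∞) (Function.uncurry f)) (x : E) :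
      Differentiable ℝ (fun s => f s x) :=
    (hf.comp (contDiff_prodMk_left x)).differentiable (by simp)
  have key (t : ℝ) (x : E) :
      √(ρ t x) * deriv (fun s => φ s x) t
        = -(ℏ ^ 2 / 2) * laplacian (fun y => √(ρ t y)) x
          + 1 / 2 * √(ρ t x) * ‖gradient (φ t) x‖ ^ 2 + V x * √(ρ t x)
      ∧ deriv (fun s => √(ρ s x)) t
        = ⟪gradient (fun y => √(ρ t y)) x, gradient (φ t) x⟫
          + 1 / 2 * √(ρ t x) * laplacian (φ t) x := by
    have h := hschrodinger t x
    have hℏ' : (ℏ : ℂ) ≠ 0 := by exact_mod_cast hℏ.ne'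
    have hRt : HasFDerivAt (fun s => ((√(ρ s x) : ℝ) : ℂ))
        (Complex.ofRealCLM.comp (fderiv ℝ (fun s => √(ρ s x)) t)) t :=
      Complex.ofRealCLM.hasFDerivAt.comp t (time hR x t).hasFDerivAt
    have ht := hRt.fderiv_mul_cexp_apply (-(Complex.I / ℏ)) (time hφ x t) 1
    simp only [ContinuousLinearMap.comp_apply, fderiv_eq_smul_deriv, one_smul,
      Complex.ofRealCLM_apply] at ht
    rw [show ψ t = fun y => _ from funext (hψ t), show (fun s => ψ s x) = fun s => _ from
      funext fun s => hψ s x, laplacian_mul_cexp _ (space hR t) (space hφ t), ht] at h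
    have h' : Complex.I * ℏ * (((deriv (fun s => √(ρ s x)) t : ℝ) : ℂ)
          + -(Complex.I / ℏ) * √(ρ t x) * ((deriv (fun s => φ s x) t : ℝ) : ℂ))
        = -((ℏ : ℂ) ^ 2 / 2) * (((laplacian (fun y => √(ρ t y)) x : ℝ) : ℂ)
          + 2 * -(Complex.I / ℏ) * (⟪gradient (fun y => √(ρ t y)) x, gradient (φ t) x⟫ : ℂ)
          + -(Complex.I / ℏ) * √(ρ t x) * ((laplacian (φ t) x : ℝ) : ℂ)
          + (-(Complex.I / ℏ)) ^ 2 * √(ρ t x) * ((‖gradient (φ t) x‖ ^ 2 : ℝ) : ℂ))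
          + V x * √(ρ t x) := by
      refine mul_right_cancel₀ (Complex.exp_ne_zero (-(Complex.I / ℏ) * (φ t x : ℂ))) ?_
      linear_combination h
    generalize deriv (fun s => √(ρ s x)) t = Rt at *
    generalize deriv (fun s => φ s x) t = φt at *
    generalize laplacian (fun y => √(ρ t y)) x = LR at *
    generalize laplacian (φ t) x = Lφ at *
    generalize ⟪gradient (fun y => √(ρ t y)) x, gradient (φ t) x⟫ = G at *
    generalize ‖gradient (φ t) x‖ ^ 2 = N at *
    generalize √(ρ t x) = R at *
    have h'' : ((R * φt : ℝ) : ℂ) + ((ℏ * Rt : ℝ) : ℂ) * Complex.I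
        = ((-(ℏ ^ 2 / 2) * LR + 1 / 2 * R * N + V x * R : ℝ) : ℂ)
          + ((ℏ * (G + 1 / 2 * R * Lφ) : ℝ) : ℂ) * Complex.I := by
      push_cast
      field_simp at h'
      linear_combination (norm := skip) (1 / 2 : ℂ) * h'
      ring_nf
      simp only [Complex.I_sq]
      ring
    constructor
    · simpa only [Complex.add_re, Complex.re_ofReal_mul, Complex.ofReal_re, Complex.I_re,
        mul_zero, add_zero] using congrArg Complex.re h''
    · exact mul_left_cancel₀ hℏ.ne' (by
        simpa only [Complex.add_im, Complex.im_ofReal_mul, Complex.ofReal_im, Complex.I_im,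
          mul_one, zero_add] using congrArg Complex.im h'')
  refine ⟨fun t x => ?_, fun t x => ?_⟩
  · have hRpos : √(ρ t x) ≠ 0 := (Real.sqrt_pos.2 (hpos t x)).ne'
    field_simp
    linear_combination 2 * (key t x).1
  · have hsq (t : ℝ) (x : E) : ρ t x = √(ρ t x) ^ 2 := (Real.sq_sqrt (hpos t x).le).symm
    have hgrad : gradient (ρ t) x = (2 * √(ρ t x)) • gradient (fun y => √(ρ t y)) x := by
      have hd := ((space hR t).differentiable (by norm_num) x).hasFDerivAt.pow 2
      rw [show ρ t = fun y => √(ρ t y) ^ 2 from funext (hsq t)]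
      simp only [gradient]
      rw [hd.fderiv]
      simp [Real.sqrt_sq]
    have hdt : deriv (fun s => ρ s x) t = 2 * √(ρ t x) * deriv (fun s => √(ρ s x)) t := by
      have hd : HasDerivAt (fun s => √(ρ s x) ^ 2) _ t := (time hR x t).hasDerivAt.pow 2
      rw [show (fun s => ρ s x) = fun s => √(ρ s x) ^ 2 from funext fun s => hsq s x, hd.deriv]
      simp
    rw [hdt, hgrad, inner_smul_left, (key t x).2]
    simp only [conj_trivial]
    linear_combination (-laplacian (φ t) x) * hsq t x
end

section
/- Let f : ℝ × ℝ → ℝ be a smooth (infinitely differentiable) function, and define its Hamiltonian vector field X_f : ℝ × ℝ → ℝ × ℝ (with respect to the standard symplectic form dx ∧ dy on ℝ² ≅ ℂ) by X_f(x,y) = (∂f/∂y(x,y), −∂f/∂x(x,y)). Then X_f is a Killing vector field for the Euclidean metric on ℝ², i.e. the Fréchet derivative of X_f at every point is a skew-adjoint linear map of ℝ², if and only if there exist real numbers a, b, c, d such that f(x,y) = a + b·x + c·y + d·(x² + y²)/2 for all (x,y). In other words, the space of Kähler functions of ℂ is spanned by the functions 1, x, y, (x²+y²)/2. -/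
lemma hasDerivAt_slice_fst {g : ℝ × ℝ → ℝ} (hg : Differentiable ℝ g) (x y : ℝ) :
    HasDerivAt (fun t => g (t, y)) (fderiv ℝ g (x, y) (1, 0)) x :=
  (hg (x, y)).hasFDerivAt.comp_hasDerivAt x
    ((hasDerivAt_id x).prodMk (hasDerivAt_const x y))

lemma hasDerivAt_slice_snd {g : ℝ × ℝ → ℝ} (hg : Differentiable ℝ g) (x y : ℝ) :
    HasDerivAt (fun t => g (x, t)) (fderiv ℝ g (x, y) (0, 1)) y :=
  (hg (x, y)).hasFDerivAt.comp_hasDerivAt y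
    ((hasDerivAt_const y x).prodMk (hasDerivAt_id y))

/-- If `∂P/∂y = 0`, `∂Q/∂x = 0` and `∂P/∂x = ∂Q/∂y`, then `P` and `Q` are affine functions of
`x` and `y` respectively, with a common slope. -/
lemma exists_affine_of_fderiv {P Q : ℝ × ℝ → ℝ} (hP : Differentiable ℝ P)
    (hQ : Differentiable ℝ Q) (hPy : ∀ p, fderiv ℝ P p (0, 1) = 0)
    (hQx : ∀ p, fderiv ℝ Q p (1, 0) = 0)
    (hPQ : ∀ p, fderiv ℝ P p (1, 0) = fderiv ℝ Q p (0, 1)) :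
    ∃ b c d : ℝ, ∀ x y, P (x, y) = b + d * x ∧ Q (x, y) = c + d * y := by
  have hP0 (x y : ℝ) : P (x, y) = P (x, 0) :=
    is_const_of_deriv_eq_zero (f := fun t => P (x, t))
      (fun t => (hasDerivAt_slice_snd hP x t).differentiableAt)
      (fun t => (hasDerivAt_slice_snd hP x t).deriv.trans (hPy _)) y 0
  have hQ0 (x y : ℝ) : Q (x, y) = Q (0, y) :=
    is_const_of_deriv_eq_zero (f := fun t => Q (t, y))
      (fun t => (hasDerivAt_slice_fst hQ t y).differentiableAt)
      (fun t => (hasDerivAt_slice_fst hQ t y).deriv.trans (hQx _)) x 0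
  have hPx (x y : ℝ) : fderiv ℝ P (x, y) (1, 0) = fderiv ℝ P (x, 0) (1, 0) := by
    have h := hasDerivAt_slice_fst hP x y
    simp only [hP0 _ y] at h
    exact h.unique (hasDerivAt_slice_fst hP x 0)
  have hQy (x y : ℝ) : fderiv ℝ Q (x, y) (0, 1) = fderiv ℝ Q (0, y) (0, 1) := by
    have h := hasDerivAt_slice_snd hQ x y
    simp only [hQ0 x] at h
    exact h.unique (hasDerivAt_slice_snd hQ 0 y)
  set d := fderiv ℝ Q (0, 0) (0, 1) with hd
  have hPd (x y : ℝ) : fderiv ℝ P (x, y) (1, 0) = d := by rw [hPx, hPQ, hQy]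
  have hQd (x y : ℝ) : fderiv ℝ Q (x, y) (0, 1) = d := by rw [← hPQ, hPd]
  have affine {g : ℝ → ℝ} (hg : ∀ t, HasDerivAt g d t) (t : ℝ) : g t = g 0 + d * t := by
    have h (s : ℝ) : HasDerivAt (fun t => g t - d * t) 0 s := by
      simpa using (hg s).fun_sub ((hasDerivAt_id' s).const_mul d)
    have := is_const_of_deriv_eq_zero (fun s => (h s).differentiableAt)
      (fun s => (h s).deriv) t 0
    simp only [mul_zero, sub_zero] at this
    linarith
  refine ⟨P (0, 0), Q (0, 0), d, fun x y => ⟨?_, ?_⟩⟩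
  · rw [hP0]
    exact affine (g := fun t => P (t, 0)) (fun t => hPd t 0 ▸ hasDerivAt_slice_fst hP t 0) x
  · rw [hQ0]
    exact affine (g := fun t => Q (0, t)) (fun t => hQd 0 t ▸ hasDerivAt_slice_snd hQ 0 t) y

lemma hasDerivAt_quadratic (a b d t : ℝ) :
    HasDerivAt (fun t => a + b * t + d * t ^ 2 / 2) (b + d * t) t := by
  have h := (((hasDerivAt_id' t).const_mul b).const_add a).fun_add
    (((hasDerivAt_pow 2 t).const_mul d).div_const 2)
  refine h.congr_deriv ?_
  norm_num
  ring

/-- A function on `ℝ` whose derivative is `t ↦ b + d * t` is a quadratic polynomial. -/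
lemma eq_quadratic_of_hasDerivAt {g : ℝ → ℝ} {b d : ℝ}
    (hg : ∀ t, HasDerivAt g (b + d * t) t) (t : ℝ) :
    g t = g 0 + b * t + d * t ^ 2 / 2 := by
  have h (s : ℝ) : HasDerivAt (fun t => g t - (0 + b * t + d * t ^ 2 / 2)) 0 s := by
    simpa only [sub_self] using (hg s).fun_sub (hasDerivAt_quadratic 0 b d s)
  have := is_const_of_deriv_eq_zero (fun s => (h s).differentiableAt)
    (fun s => (h s).deriv) t 0
  norm_num at this
  linarith

theorem kahler_functions_of_C (f : ℝ × ℝ → ℝ) (hf : ContDiff ℝ (⊤ : ℕ∞) f)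
    (X : ℝ × ℝ → ℝ × ℝ)
    (hX : ∀ p : ℝ × ℝ,
      X p = (deriv (fun y => f (p.1, y)) p.2, - deriv (fun x => f (x, p.2)) p.1)) :
    (∀ p v w : ℝ × ℝ,
        (fderiv ℝ X p v).1 * w.1 + (fderiv ℝ X p v).2 * w.2
          + v.1 * (fderiv ℝ X p w).1 + v.2 * (fderiv ℝ X p w).2 = 0)
      ↔ ∃ a b c d : ℝ, ∀ x y : ℝ,
          f (x, y) = a + b * x + c * y + d * (x ^ 2 + y ^ 2) / 2 := by
  have hfd : Differentiable ℝ f := hf.differentiable (by simp)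
  have hf' : Differentiable ℝ (fderiv ℝ f) :=
    (hf.fderiv_right (m := 1) (by norm_cast)).differentiable (by simp)
  constructor
  · intro h
    have hP : Differentiable ℝ (fun p => fderiv ℝ f p (1, 0)) := by fun_prop
    have hQ : Differentiable ℝ (fun p => fderiv ℝ f p (0, 1)) := by fun_prop
    have hXeq : X = fun p => (fderiv ℝ f p (0, 1), -fderiv ℝ f p (1, 0)) := by
      funext p
      rw [hX, (hasDerivAt_slice_snd hfd p.1 p.2).deriv, (hasDerivAt_slice_fst hfd p.1 p.2).deriv]
    have hX' (p v : ℝ × ℝ) : fderiv ℝ X p v =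
        (fderiv ℝ (fun p => fderiv ℝ f p (0, 1)) p v,
          -fderiv ℝ (fun p => fderiv ℝ f p (1, 0)) p v) := by
      rw [hXeq, ((hQ p).hasFDerivAt.prodMk (hP p).hasFDerivAt.fun_neg).fderiv]
      rfl
    simp only [hX'] at h
    obtain ⟨b, c, d, hbcd⟩ := exists_affine_of_fderiv hP hQ
      (fun p => by have := h p (0, 1) (0, 1); norm_num at this; linarith)
      (fun p => by have := h p (1, 0) (1, 0); norm_num at this; linarith)
      (fun p => by have := h p (1, 0) (0, 1); norm_num at this; linarith)
    refine ⟨f (0, 0), b, c, d, fun x y => ?_⟩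
    have hx := eq_quadratic_of_hasDerivAt (g := fun t => f (t, y))
      (fun t => (hbcd t y).1 ▸ hasDerivAt_slice_fst hfd t y) x
    have hy := eq_quadratic_of_hasDerivAt (g := fun t => f (0, t))
      (fun t => (hbcd 0 t).2 ▸ hasDerivAt_slice_snd hfd 0 t) y
    linarith
  · rintro ⟨a, b, c, d, h⟩
    have hXeq : X = fun p => (c + d * p.2, -(b + d * p.1)) := by
      funext p
      have hy : (fun y => f (p.1, y)) =
          fun y => (a + b * p.1 + d * p.1 ^ 2 / 2) + c * y + d * y ^ 2 / 2 := by
        funext y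
        rw [h]
        ring
      have hx : (fun x => f (x, p.2)) =
          fun x => (a + c * p.2 + d * p.2 ^ 2 / 2) + b * x + d * x ^ 2 / 2 := by
        funext x
        rw [h]
        ring
      rw [hX, hx, hy, (hasDerivAt_quadratic _ c d p.2).deriv,
        (hasDerivAt_quadratic _ b d p.1).deriv]
    intro p v w
    have hX' : HasFDerivAt X ((d • ContinuousLinearMap.snd ℝ ℝ ℝ).prod
        (-(d • ContinuousLinearMap.fst ℝ ℝ ℝ))) p := by
      rw [hXeq]
      exact ((hasFDerivAt_snd.const_mul d).const_add c).prodMk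
        ((hasFDerivAt_fst.const_mul d).const_add b).neg
    rw [hX'.fderiv]
    simp
    ring
end

section
/- Let ℏ > 0 and let a, b, c, d, x, y be real numbers. Define Ψ : ℝ → ℂ by Ψ(ξ) = (2π)^(−1/4)·exp(−(ξ−x)²/4)·exp(−(i/ℏ)·y·ξ). Then ∫_ℝ conj(Ψ(ξ)) · ( a·Ψ(ξ) + b·ξ·Ψ(ξ) + c·(iℏ·Ψ'(ξ)) + d·( −(ℏ²/2)·Ψ''(ξ) + (ξ²/2 − ℏ²/8 − 1/2)·Ψ(ξ) ) ) dξ = a + b·x + c·y + d·(x² + y²)/2. That is, for every function f in the span of the Kähler functions 1, x, y, (x²+y²)/2 of ℂ, one has f(x+iy) = ⟨Ψ, Q(f)·Ψ⟩, where Q maps 1 ↦ Id, x ↦ multiplication by ξ, y ↦ iℏ·d/dξ, and (x²+y²)/2 ↦ −(ℏ²/2)·d²/dξ² + ξ²/2 − (ℏ²/8 + 1/2). -/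
open MeasureTheory Complex

/-- The first derivative of a complex Gaussian wave packet. -/
lemma hasDerivAt_gaussian_wave (k : ℂ) (x : ℝ) (w : ℂ) (ξ : ℝ) :
    HasDerivAt (fun ξ : ℝ => k * Complex.exp (-((ξ : ℂ) - x) ^ 2 / 4) * Complex.exp (w * ξ))
      ((-((ξ : ℂ) - x) / 2 + w)
        * (k * Complex.exp (-((ξ : ℂ) - x) ^ 2 / 4) * Complex.exp (w * ξ))) ξ := by
  have hid : HasDerivAt (fun ξ : ℝ => (ξ : ℂ)) 1 ξ := Complex.ofRealCLM.hasDerivAt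
  have hquad : HasDerivAt (fun ξ : ℝ => -((ξ : ℂ) - x) ^ 2 / 4) (-((ξ : ℂ) - x) / 2) ξ := by
    refine (((hid.sub_const (x : ℂ)).pow 2).neg.div_const 4).congr_deriv ?_
    push_cast
    ring
  refine ((hquad.cexp.const_mul k).mul (hid.const_mul w).cexp).congr_deriv ?_
  ring

/-- A real Gaussian wave packet with purely imaginary phase has a Gaussian density as its squared
modulus. -/
lemma conj_mul_self_gaussian_wave (x s ξ : ℝ) :
    (starRingEnd ℂ) (((2 * Real.pi) ^ (-(1/4 : ℝ)) : ℝ)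
        * Complex.exp (-((ξ : ℂ) - x) ^ 2 / 4) * Complex.exp (s * Complex.I))
      * (((2 * Real.pi) ^ (-(1/4 : ℝ)) : ℝ)
        * Complex.exp (-((ξ : ℂ) - x) ^ 2 / 4) * Complex.exp (s * Complex.I))
      = (ProbabilityTheory.gaussianPDFReal x 1 ξ : ℂ) := by
  have hexp : Complex.exp (-((ξ : ℂ) - x) ^ 2 / 4)
      = ((Real.exp (-(ξ - x) ^ 2 / 4) : ℝ) : ℂ) := by push_cast; rfl
  rw [mul_comm, Complex.mul_conj, Complex.normSq_eq_norm_sq, norm_mul, hexp,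
    Complex.norm_exp_ofReal_mul_I, mul_one, ← Complex.ofReal_mul, Complex.norm_real,
    Real.norm_eq_abs, sq_abs, ProbabilityTheory.gaussianPDFReal, mul_pow, ← Real.exp_nat_mul]
  have hpi : 0 ≤ 2 * Real.pi := by positivity
  congr 2
  · rw [← Real.rpow_mul_natCast hpi, Real.sqrt_eq_rpow, ← Real.rpow_neg (by simpa using hpi)]
    norm_num
  · congr 1
    push_cast
    ring

/-- The expectation of a complex quadratic polynomial, centred at the mean, under a Gaussian
distribution of variance one. -/
lemma integral_centered_quadratic_gaussianReal (x : ℝ) (p q r : ℂ) :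
    ∫ ξ : ℝ, (p + q * ((ξ - x : ℝ) : ℂ) + r * (((ξ - x) ^ 2 : ℝ) : ℂ))
      ∂(ProbabilityTheory.gaussianReal x 1) = p + r := by
  have hL : MemLp (fun ξ : ℝ => ξ - x) 2 (ProbabilityTheory.gaussianReal x 1) :=
    (ProbabilityTheory.memLp_id_gaussianReal 2).sub (memLp_const x)
  have h1 : Integrable (fun ξ : ℝ => ξ - x) (ProbabilityTheory.gaussianReal x 1) :=
    hL.integrable (by norm_num)
  have h2 : Integrable (fun ξ : ℝ => (ξ - x) ^ 2) (ProbabilityTheory.gaussianReal x 1) :=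
    hL.integrable_sq
  have hid : Integrable (fun ξ : ℝ => ξ) (ProbabilityTheory.gaussianReal x 1) :=
    (ProbabilityTheory.memLp_id_gaussianReal 1).integrable le_rfl
  have mean : ∫ ξ : ℝ, (ξ - x) ∂(ProbabilityTheory.gaussianReal x 1) = 0 := by
    rw [integral_sub hid (integrable_const x), ProbabilityTheory.integral_id_gaussianReal]
    simp
  have var : ∫ ξ : ℝ, (ξ - x) ^ 2 ∂(ProbabilityTheory.gaussianReal x 1) = 1 := by
    have h := ProbabilityTheory.variance_fun_id_gaussianReal (μ := x) (v := 1)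
    rw [ProbabilityTheory.variance_eq_integral (by fun_prop),
      ProbabilityTheory.integral_id_gaussianReal] at h
    simpa using h
  have hq : Integrable (fun ξ : ℝ => q * ((ξ - x : ℝ) : ℂ))
      (ProbabilityTheory.gaussianReal x 1) := h1.ofReal.const_mul q
  have hr : Integrable (fun ξ : ℝ => r * (((ξ - x) ^ 2 : ℝ) : ℂ))
      (ProbabilityTheory.gaussianReal x 1) := h2.ofReal.const_mul r
  have hpq : Integrable (fun ξ : ℝ => p + q * ((ξ - x : ℝ) : ℂ))
      (ProbabilityTheory.gaussianReal x 1) := (integrable_const p).add hq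
  rw [integral_add hpq hr, integral_add (integrable_const p) hq, integral_const_mul,
    integral_const_mul, integral_complex_ofReal, integral_complex_ofReal, mean, var]
  simp

theorem kahler_expectation (ℏ : ℝ) (hℏ : 0 < ℏ) (a b c d x y : ℝ)
    (Ψ : ℝ → ℂ)
    (hΨ : ∀ ξ : ℝ, Ψ ξ = ((2 * Real.pi) ^ (-(1/4 : ℝ)) : ℝ)
      * Complex.exp (-((ξ : ℂ) - x) ^ 2 / 4) * Complex.exp (-(Complex.I / ℏ) * y * ξ)) :
    ∫ ξ : ℝ, (starRingEnd ℂ) (Ψ ξ)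
        * ((a : ℂ) * Ψ ξ + (b : ℂ) * (ξ : ℂ) * Ψ ξ
          + (c : ℂ) * (Complex.I * (ℏ : ℂ) * deriv Ψ ξ)
          + (d : ℂ) * (-((ℏ : ℂ) ^ 2 / 2) * deriv (deriv Ψ) ξ
              + ((ξ : ℂ) ^ 2 / 2 - (ℏ : ℂ) ^ 2 / 8 - 1 / 2) * Ψ ξ))
      = (a : ℂ) + (b : ℂ) * x + (c : ℂ) * y + (d : ℂ) * ((x : ℂ) ^ 2 + (y : ℂ) ^ 2) / 2 := by
  have hℏ' : (ℏ : ℂ) ≠ 0 := by exact_mod_cast hℏ.ne'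
  have hderiv (ξ : ℝ) :
      HasDerivAt Ψ ((-((ξ : ℂ) - x) / 2 + -(Complex.I / ℏ) * y) * Ψ ξ) ξ := by
    have h := hasDerivAt_gaussian_wave
      (((2 * Real.pi) ^ (-(1/4 : ℝ)) : ℝ) : ℂ) x (-(Complex.I / ℏ) * y) ξ
    rwa [← hΨ ξ, ← funext hΨ] at h
  have hderiv_eq : deriv Ψ = fun ξ : ℝ => (-((ξ : ℂ) - x) / 2 + -(Complex.I / ℏ) * y) * Ψ ξ :=
    funext fun ξ => (hderiv ξ).deriv
  have hderiv2 (ξ : ℝ) : deriv (deriv Ψ) ξ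
      = ((-((ξ : ℂ) - x) / 2 + -(Complex.I / ℏ) * y) ^ 2 - 1 / 2) * Ψ ξ := by
    have hid : HasDerivAt (fun ξ : ℝ => (ξ : ℂ)) 1 ξ := Complex.ofRealCLM.hasDerivAt
    have h := (((hid.sub_const (x : ℂ)).neg.div_const 2).add_const
      (-(Complex.I / ℏ) * y)).mul (hderiv ξ)
    rw [hderiv_eq]
    refine h.deriv.trans ?_
    simp only [Pi.neg_apply]
    ring
  have hnorm (ξ : ℝ) : (starRingEnd ℂ) (Ψ ξ) * Ψ ξ
      = (ProbabilityTheory.gaussianPDFReal x 1 ξ : ℂ) := by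
    rw [← conj_mul_self_gaussian_wave x (-(y * ξ / ℏ)) ξ, hΨ]
    have : -(Complex.I / ℏ) * y * ξ = ((-(y * ξ / ℏ) : ℝ) : ℂ) * Complex.I := by
      push_cast
      ring
    rw [this]
  have hmain := integral_centered_quadratic_gaussianReal x
    (a + b * x + c * y + d * ((x : ℂ) ^ 2 / 2 + (y : ℂ) ^ 2 / 2 + (ℏ : ℂ) ^ 2 / 8 - 1 / 2))
    (b - c * Complex.I * ℏ / 2 + d * (x - Complex.I * ℏ * y / 2))
    (d * (1 / 2 - (ℏ : ℂ) ^ 2 / 8))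
  rw [ProbabilityTheory.integral_gaussianReal_eq_integral_smul one_ne_zero] at hmain
  calc
    _ = _ := integral_congr_ae (Filter.Eventually.of_forall fun ξ => ?_)
    _ = _ := hmain
    _ = _ := by ring
  simp only [Complex.real_smul]
  rw [hderiv2, hderiv_eq, ← hnorm]
  push_cast
  field_simp
  ring_nf
  simp only [Complex.I_sq]
  ring
end

section
/- Let ℏ > 0 and let x, y be real numbers. Define Ψ : ℝ → ℂ by Ψ(ξ) = (2π)^(−1/4)·exp(−(ξ−x)²/4)·exp(−(i/ℏ)·y·ξ). Then ∫_ℝ conj(Ψ(ξ)) · ( −(ℏ²/2)·Ψ''(ξ) + (ξ²/2 − ℏ²/8 − 1/2)·Ψ(ξ) ) dξ = (x² + y²)/2, i.e. the expectation of the operator −(ℏ²/2)·d²/dξ² + ξ²/2 − (ℏ²/8 + 1/2) in the state Ψ equals the complex number (x²+y²)/2. -/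
open MeasureTheory Complex

open ProbabilityTheory in
theorem integral_quadratic_gaussianReal (m : ℝ) (v : NNReal) (a b c : ℂ) :
    ∫ t : ℝ, (a * (t : ℂ) ^ 2 + b * t + c) ∂(gaussianReal m v) = a * (m ^ 2 + v) + b * m + c := by
  have hL : MemLp (fun t : ℝ => t) 2 (gaussianReal m v) := memLp_id_gaussianReal 2
  have h1 : Integrable (fun t : ℝ => (t : ℂ)) (gaussianReal m v) :=
    (hL.integrable (by norm_num)).ofReal
  have h2 : Integrable (fun t : ℝ => (t : ℂ) ^ 2) (gaussianReal m v) := by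
    simpa using hL.integrable_sq.ofReal (𝕜 := ℂ)
  have e1 : ∫ t : ℝ, (t : ℂ) ∂(gaussianReal m v) = m := by
    rw [integral_complex_ofReal, integral_id_gaussianReal]
  have e2 : ∫ t : ℝ, (t : ℂ) ^ 2 ∂(gaussianReal m v) = m ^ 2 + v := by
    have hv := variance_eq_sub hL
    rw [variance_fun_id_gaussianReal, integral_id_gaussianReal] at hv
    have hr : ∫ t : ℝ, t ^ 2 ∂(gaussianReal m v) = m ^ 2 + v := by
      simp only [Pi.pow_apply] at hv
      linarith
    simp_rw [← ofReal_pow]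
    rw [integral_complex_ofReal, hr]
    push_cast
    rfl
  have h12 : Integrable (fun t : ℝ => a * (t : ℂ) ^ 2 + b * t) (gaussianReal m v) :=
    (h2.const_mul a).add (h1.const_mul b)
  rw [integral_add h12 (integrable_const c),
    integral_add (h2.const_mul a) (h1.const_mul b), integral_const_mul, integral_const_mul, e1, e2]
  simp

/-- A wave packet with Gaussian modulus: its derivative is a multiple of itself. -/
theorem hasDerivAt_gaussian_wavePacket (k w z : ℂ) (ξ : ℝ) :
    HasDerivAt (fun ξ : ℝ => k * exp (-((ξ : ℂ) - z) ^ 2 / 4) * exp (-w * ξ))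
      ((-((ξ : ℂ) - z) / 2 - w) * (k * exp (-((ξ : ℂ) - z) ^ 2 / 4) * exp (-w * ξ))) ξ := by
  have h0 : HasDerivAt (fun ξ : ℝ => (ξ : ℂ)) 1 ξ := ofRealCLM.hasDerivAt
  convert! ((((h0.sub_const z).pow 2).neg.div_const 4).cexp.const_mul k).mul
    (h0.const_mul (-w)).cexp using 1
  simp only [Pi.neg_apply, Pi.pow_apply]
  push_cast
  ring

theorem deriv_deriv_gaussian_wavePacket (k w z : ℂ) (ξ : ℝ) :
    deriv (deriv fun ξ : ℝ => k * exp (-((ξ : ℂ) - z) ^ 2 / 4) * exp (-w * ξ)) ξ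
      = ((-((ξ : ℂ) - z) / 2 - w) ^ 2 - 1 / 2)
        * (k * exp (-((ξ : ℂ) - z) ^ 2 / 4) * exp (-w * ξ)) := by
  have h0 : HasDerivAt (fun ξ : ℝ => (ξ : ℂ)) 1 ξ := ofRealCLM.hasDerivAt
  rw [funext fun t => (hasDerivAt_gaussian_wavePacket k w z t).deriv]
  have h := ((((h0.sub_const z).neg.div_const 2).sub_const w).mul
    (hasDerivAt_gaussian_wavePacket k w z ξ)).deriv
  refine Eq.trans h ?_
  simp only [Pi.neg_apply]
  ring

open ProbabilityTheory in
theorem conj_mul_self_gaussian_wavePacket (x p ξ : ℝ) :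
    (starRingEnd ℂ) (((2 * Real.pi) ^ (-(1/4 : ℝ)) : ℝ)
        * exp (-((ξ : ℂ) - x) ^ 2 / 4) * exp (-(I * p) * ξ))
      * (((2 * Real.pi) ^ (-(1/4 : ℝ)) : ℝ)
        * exp (-((ξ : ℂ) - x) ^ 2 / 4) * exp (-(I * p) * ξ))
      = gaussianPDFReal x 1 ξ := by
  have hpi : (0 : ℝ) < 2 * Real.pi := by positivity
  have hk : ((2 * Real.pi) ^ (-(1/4 : ℝ))) ^ 2 = (√(2 * Real.pi))⁻¹ := by
    rw [← Real.rpow_natCast, ← Real.rpow_mul hpi.le, Real.sqrt_eq_rpow, ← Real.rpow_neg hpi.le]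
    norm_num
  have he : Real.exp (-(ξ - x) ^ 2 / 4) ^ 2 = Real.exp (-(ξ - x) ^ 2 / 2) := by
    rw [← Real.exp_nat_mul]
    congr 1
    push_cast
    ring
  have hp : ‖exp (-(I * p) * ξ)‖ = 1 := by
    rw [show -(I * (p : ℂ)) * ξ = ((-(p * ξ) : ℝ) : ℂ) * I by push_cast; ring]
    exact norm_exp_ofReal_mul_I _
  have hg : exp (-((ξ : ℂ) - x) ^ 2 / 4) = (Real.exp (-(ξ - x) ^ 2 / 4) : ℝ) := by
    push_cast
    rfl
  rw [conj_mul', norm_mul, norm_mul, hp, hg, norm_real, norm_real, Real.norm_eq_abs,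
    Real.norm_eq_abs, ← ofReal_pow, mul_one, mul_pow, sq_abs, sq_abs, hk, he, gaussianPDFReal]
  simp

theorem energy_expectation (ℏ : ℝ) (hℏ : 0 < ℏ) (x y : ℝ)
    (Ψ : ℝ → ℂ)
    (hΨ : ∀ ξ : ℝ, Ψ ξ = ((2 * Real.pi) ^ (-(1/4 : ℝ)) : ℝ)
      * Complex.exp (-((ξ : ℂ) - x) ^ 2 / 4) * Complex.exp (-(Complex.I / ℏ) * y * ξ)) :
    ∫ ξ : ℝ, (starRingEnd ℂ) (Ψ ξ)
        * (-((ℏ : ℂ) ^ 2 / 2) * deriv (deriv Ψ) ξ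
          + ((ξ : ℂ) ^ 2 / 2 - (ℏ : ℂ) ^ 2 / 8 - 1 / 2) * Ψ ξ)
      = ((x : ℂ) ^ 2 + (y : ℂ) ^ 2) / 2 := by
  have hΨ' : Ψ = fun ξ : ℝ => (((2 * Real.pi) ^ (-(1/4 : ℝ)) : ℝ) : ℂ)
      * exp (-((ξ : ℂ) - x) ^ 2 / 4) * exp (-(I * (y / ℏ : ℝ)) * ξ) := by
    funext ξ
    rw [hΨ]
    congr 2
    push_cast
    ring
  have hd : ∀ ξ : ℝ, deriv (deriv Ψ) ξ
      = ((-((ξ : ℂ) - x) / 2 - I * (y / ℏ : ℝ)) ^ 2 - 1 / 2) * Ψ ξ := by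
    intro ξ
    rw [hΨ']
    exact deriv_deriv_gaussian_wavePacket _ _ _ ξ
  have hn : ∀ ξ : ℝ, (starRingEnd ℂ) (Ψ ξ) * Ψ ξ
      = ProbabilityTheory.gaussianPDFReal x 1 ξ := by
    intro ξ
    rw [hΨ']
    exact conj_mul_self_gaussian_wavePacket x (y / ℏ) ξ
  have key := integral_quadratic_gaussianReal x 1 (-(ℏ : ℂ) ^ 2 / 8 + 1 / 2)
    ((ℏ : ℂ) ^ 2 / 2 * (x / 2 - I * (y / ℏ : ℝ)))
    (-((ℏ : ℂ) ^ 2 / 2) * ((x / 2 - I * (y / ℏ : ℝ)) ^ 2 - 1 / 2) - (ℏ : ℂ) ^ 2 / 8 - 1 / 2)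
  rw [ProbabilityTheory.integral_gaussianReal_eq_integral_smul one_ne_zero] at key
  have hℏ' : (ℏ : ℂ) ≠ 0 := ofReal_ne_zero.mpr hℏ.ne'
  refine Eq.trans (integral_congr_ae (.of_forall fun ξ => ?_)) (key.trans ?_)
  · simp only [hd, real_smul, ← hn]
    ring
  · push_cast
    field_simp
    ring_nf
    simp only [I_sq]
    ring
end
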